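/- arXiv:1407.4951 — 2 statements merged into one kernel-verified Lean document; each statement's English description precedes it below -/
import Mathlib

section
/- Let d ≥ 2 and N, M be integers with 1 ≤ M and 2M ≤ N. Then the characteristic polynomial of the real symmetric matrix G_0^{(M)} (of size C(N,M)) equals Π_{k=0}^{M} (X − λ_k)^{m_k}, where λ_k = C(d−2+k, k) · C(N+d−1, M) / (C(M+d−1, M) · C(N+d−1, k)) and m_k = C(N, k) − C(N, k−1), with the convention C(N, −1) = 0. In particular, for each k = 0, …, M, λ_k is an eigenvalue of G_0^{(M)} with multiplicity C(N, k) − C(N, k−1). -/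
/-- Hamming weight of a bit string. -/
def wt {N : ℕ} (x : Fin N → Bool) : ℕ := (Finset.univ.filter (fun i => x i = true)).card

/-- Number of positions at which both bit strings are 1. -/
def dotB {N : ℕ} (x z : Fin N → Bool) : ℕ :=
  (Finset.univ.filter (fun i => x i = true ∧ z i = true)).card

/-- The bit strings of length `N` and Hamming weight `M`. -/
abbrev WtStr (N M : ℕ) := {x : Fin N → Bool // wt x = M}

/-- The (x,z) entry of the matrix `G_y^{(M)}`:
`1 / C(M + d − 1 − x·z + |x̄ ∧ z̄ ∧ y|, d − 1)`. -/
noncomputable def gEnt (d M : ℕ) {N : ℕ} (y x z : Fin N → Bool) : ℝ :=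
  1 / (Nat.choose (M + d - 1 - dotB x z + wt (fun i => (!x i && !z i && y i))) (d - 1) : ℝ)

/-- The matrix `G_y^{(M)}`, indexed by the weight-`M` bit strings of length `N`. -/
noncomputable def gMatM (d M : ℕ) {N : ℕ} (y : Fin N → Bool) :
    Matrix (WtStr N M) (WtStr N M) ℝ :=
  Matrix.of fun x z => gEnt d M y x.1 z.1

open Polynomial in
theorem charpoly_shift_aux {n : Type*} [Fintype n] [DecidableEq n] (A : Matrix n n ℝ) (b : ℝ) :
    (A + b • (1 : Matrix n n ℝ)).charpoly = A.charpoly.comp (X - C b) := by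
  have h := Matrix.charpoly_sub_scalar A (-b)
  have h2 : A - Matrix.scalar n (-b) = A + b • (1 : Matrix n n ℝ) := by
    rw [Matrix.scalar_apply, ← Matrix.smul_one_eq_diagonal, neg_smul, sub_neg_eq_add]
  rw [h2] at h
  rw [h, C_neg, sub_eq_add_neg]

noncomputable def gg (e j : ℕ) : ℝ := 1 / (Nat.choose (j + e + 1) (e + 1) : ℝ)

theorem gg_zero (e : ℕ) : gg e 0 = 1 := by simp [gg]

theorem gg_succ (e j : ℕ) : ((j : ℝ) + 1) * gg e j = (j + e + 2) * gg e (j + 1) := by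
  have h := Nat.choose_mul_succ_eq (j + e + 1) (e + 1)
  have h3 : j + e + 1 + 1 - (e + 1) = j + 1 := by omega
  rw [h3] at h
  have p1 : (0 : ℝ) < Nat.choose (j + e + 1) (e + 1) := by
    exact_mod_cast Nat.choose_pos (by omega)
  have p2 : (0 : ℝ) < Nat.choose (j + 1 + e + 1) (e + 1) := by
    exact_mod_cast Nat.choose_pos (by omega)
  have e1 : j + e + 1 + 1 = j + 1 + e + 1 := by omega
  rw [e1] at h
  have h' : (Nat.choose (j + e + 1) (e + 1) : ℝ) * (j + 1 + e + 1)
    = (Nat.choose (j + 1 + e + 1) (e + 1) : ℝ) * (j + 1) := by exact_mod_cast h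
  unfold gg
  field_simp
  linarith

abbrev FS (N M : ℕ) := {s : Finset (Fin N) // s.card = M}

noncomputable def GF (e N M : ℕ) : Matrix (FS N M) (FS N M) ℝ :=
  Matrix.of fun s t => gg e (M - (s.1 ∩ t.1).card)

noncomputable def EE (N M : ℕ) : Matrix (FS N (M + 1)) (FS N M) ℝ :=
  Matrix.of fun x s => if s.1 ⊆ x.1 then 1 else 0

noncomputable def BB (e N M : ℕ) : Matrix (FS N M) (FS N (M + 1)) ℝ :=
  Matrix.of fun s x => gg e (M - (s.1 ∩ x.1).card) / (M + e + 2)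

theorem sum_down {N M : ℕ} (x : FS N (M + 1)) (f : Finset (Fin N) → ℝ) :
    ∑ s : FS N M, (if s.1 ⊆ x.1 then 1 else 0) * f s.1 = ∑ a ∈ x.1, f (x.1.erase a) := by
  simp only [ite_mul, one_mul, zero_mul]
  rw [← Finset.sum_filter]
  symm
  refine Finset.sum_bij (fun a ha => (⟨x.1.erase a, by
    rw [Finset.card_erase_of_mem ha, x.2]; rfl⟩ : FS N M)) ?_ ?_ ?_ ?_
  · intro a ha
    simp [Finset.erase_subset]
  · intro a ha b hb hab
    exact Finset.erase_injOn x.1 ha hb (Subtype.ext_iff.1 hab)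
  · rintro ⟨s, hs⟩ h
    have hsx : s ⊆ x.1 := by simpa using h
    have hc : (x.1 \ s).card = 1 := by
      rw [Finset.card_sdiff_of_subset hsx, x.2, hs]; omega
    obtain ⟨a, ha⟩ := Finset.card_eq_one.1 hc
    have ha' : a ∈ x.1 \ s := by rw [ha]; simp
    refine ⟨a, (Finset.mem_sdiff.1 ha').1, ?_⟩
    apply Subtype.ext
    show x.1.erase a = s
    rw [← Finset.sdiff_singleton_eq_erase, ← ha, Finset.sdiff_sdiff_eq_self hsx]
  · intro a ha; rfl

theorem sum_up {N M : ℕ} (t : FS N M) (f : Finset (Fin N) → ℝ) :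
    ∑ x : FS N (M + 1), f x.1 * (if t.1 ⊆ x.1 then 1 else 0) = ∑ a ∈ t.1ᶜ, f (insert a t.1) := by
  simp only [mul_ite, mul_one, mul_zero]
  rw [← Finset.sum_filter]
  symm
  refine Finset.sum_bij (fun a ha => (⟨insert a t.1, by
    rw [Finset.card_insert_of_notMem (Finset.mem_compl.1 ha), t.2]⟩ : FS N (M + 1))) ?_ ?_ ?_ ?_
  · intro a ha
    simp [Finset.subset_insert]
  · intro a ha b hb hab
    have h : insert a t.1 = insert b t.1 := Subtype.ext_iff.1 hab
    have h2 : a ∈ insert b t.1 := by rw [← h]; simp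
    rcases Finset.mem_insert.1 h2 with h3 | h3
    · exact h3
    · exact absurd h3 (Finset.mem_compl.1 ha)
  · rintro ⟨x, hx⟩ h
    have htx : t.1 ⊆ x := by simpa using h
    have hc : (x \ t.1).card = 1 := by
      rw [Finset.card_sdiff_of_subset htx, t.2, hx]; omega
    obtain ⟨a, ha⟩ := Finset.card_eq_one.1 hc
    have ha' : a ∈ x \ t.1 := by rw [ha]; simp
    refine ⟨a, Finset.mem_compl.2 (Finset.mem_sdiff.1 ha').2, ?_⟩
    apply Subtype.ext
    show insert a t.1 = x
    rw [Finset.insert_eq, ← ha, Finset.sdiff_union_of_subset htx]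
  · intro a ha; rfl

theorem EB_eq (e N M : ℕ) :
    EE N M * BB e N M = GF e N (M + 1) - (((e : ℝ) + 1) / (M + e + 2)) • 1 := by
  have hK : (0 : ℝ) < M + e + 2 := by positivity
  ext x z
  rw [Matrix.mul_apply]
  simp only [EE, BB, GF, Matrix.of_apply, Matrix.sub_apply, Matrix.smul_apply, Matrix.one_apply]
  rw [sum_down x (fun s => gg e (M - (s ∩ z.1).card) / ((M : ℝ) + e + 2))]
  rw [← Finset.sum_div]
  rw [← Finset.sum_inter_add_sum_sdiff x.1 z.1]
  have h1 : ∑ a ∈ x.1 ∩ z.1, gg e (M - (x.1.erase a ∩ z.1).card)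
      = ∑ a ∈ x.1 ∩ z.1, gg e (M + 1 - (x.1 ∩ z.1).card) := by
    refine Finset.sum_congr rfl fun a ha => ?_
    rw [Finset.erase_inter, Finset.card_erase_of_mem ha]
    have : 0 < (x.1 ∩ z.1).card := Finset.card_pos.2 ⟨a, ha⟩
    congr 1; omega
  have h2 : ∑ a ∈ x.1 \ z.1, gg e (M - (x.1.erase a ∩ z.1).card)
      = ∑ a ∈ x.1 \ z.1, gg e (M - (x.1 ∩ z.1).card) := by
    refine Finset.sum_congr rfl fun a ha => ?_
    rw [Finset.erase_inter, Finset.erase_eq_of_notMem]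
    intro h
    exact (Finset.mem_sdiff.1 ha).2 (Finset.mem_inter.1 h).2
  rw [h1, h2, Finset.sum_const, Finset.sum_const, nsmul_eq_mul, nsmul_eq_mul]
  have hcard : (x.1 ∩ z.1).card + (x.1 \ z.1).card = M + 1 := by
    rw [Finset.card_inter_add_card_sdiff, x.2]
  by_cases hxz : x = z
  · subst hxz
    simp [x.2, gg_zero]
    field_simp
    ring
  · have hlt : 0 < (x.1 \ z.1).card := by
      rw [Finset.card_pos, Finset.sdiff_nonempty]
      intro h
      exact hxz (Subtype.ext (Finset.eq_of_subset_of_card_le h (by rw [x.2, z.2])))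
    obtain ⟨j, hj⟩ := Nat.exists_eq_add_of_lt hlt
    rw [zero_add] at hj
    have e1 : M + 1 - (x.1 ∩ z.1).card = j + 1 := by omega
    have e2 : M - (x.1 ∩ z.1).card = j := by omega
    have e3 : ((x.1 ∩ z.1).card : ℝ) = M - j := by
      have : (x.1 ∩ z.1).card + j = M := by omega
      have h' : ((x.1 ∩ z.1).card : ℝ) + j = M := by exact_mod_cast this
      linarith
    have := gg_succ e j
    rw [e1, e2, e3, hj, if_neg hxz]
    push_cast
    rw [this]
    field_simp
    ring

theorem BE_eq (e N M : ℕ) (hMN : 2 * (M + 1) ≤ N) :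
    BB e N M * EE N M = (((N : ℝ) + e + 1 - M) / (M + e + 2)) • GF e N M
      - (((e : ℝ) + 1) / (M + e + 2)) • 1 := by
  have hK : (0 : ℝ) < M + e + 2 := by positivity
  ext s t
  rw [Matrix.mul_apply]
  simp only [EE, BB, GF, Matrix.of_apply, Matrix.sub_apply, Matrix.smul_apply, Matrix.one_apply]
  rw [sum_up t (fun x => gg e (M - (s.1 ∩ x).card) / ((M : ℝ) + e + 2))]
  rw [← Finset.sum_div]
  rw [← Finset.sum_inter_add_sum_sdiff t.1ᶜ s.1]
  have h1 : ∑ a ∈ t.1ᶜ ∩ s.1, gg e (M - (s.1 ∩ insert a t.1).card)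
      = ∑ a ∈ t.1ᶜ ∩ s.1, gg e (M - ((s.1 ∩ t.1).card + 1)) := by
    refine Finset.sum_congr rfl fun a ha => ?_
    have ha1 := Finset.mem_inter.1 ha
    rw [Finset.inter_insert_of_mem ha1.2, Finset.card_insert_of_notMem]
    intro h
    exact Finset.mem_compl.1 ha1.1 (Finset.mem_inter.1 h).2
  have h2 : ∑ a ∈ t.1ᶜ \ s.1, gg e (M - (s.1 ∩ insert a t.1).card)
      = ∑ a ∈ t.1ᶜ \ s.1, gg e (M - (s.1 ∩ t.1).card) := by
    refine Finset.sum_congr rfl fun a ha => ?_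
    rw [Finset.inter_insert_of_notMem (Finset.mem_sdiff.1 ha).2]
  rw [h1, h2, Finset.sum_const, Finset.sum_const, nsmul_eq_mul, nsmul_eq_mul]
  have hc1 : (t.1ᶜ ∩ s.1).card + (t.1ᶜ \ s.1).card = N - M := by
    rw [Finset.card_inter_add_card_sdiff, Finset.card_compl, t.2, Fintype.card_fin]
  have hc2 : (s.1 ∩ t.1).card + (t.1ᶜ ∩ s.1).card = M := by
    have : t.1ᶜ ∩ s.1 = s.1 \ t.1 := by ext a; simp [and_comm]
    rw [this, Finset.card_inter_add_card_sdiff, s.2]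
  have hc3 : ((t.1ᶜ \ s.1).card : ℝ) = N - M - (t.1ᶜ ∩ s.1).card := by
    have : (t.1ᶜ \ s.1).card + (t.1ᶜ ∩ s.1).card + M = N := by omega
    have h' : ((t.1ᶜ \ s.1).card : ℝ) + (t.1ᶜ ∩ s.1).card + M = N := by exact_mod_cast this
    linarith
  rw [hc3]
  by_cases hst : s = t
  · subst hst
    simp [s.2, gg_zero]
    field_simp
    ring
  · have hlt : 0 < (t.1ᶜ ∩ s.1).card := by
      rcases Nat.eq_zero_or_pos (t.1ᶜ ∩ s.1).card with h | h
      · exfalso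
        apply hst
        have h5 : s.1 ∩ t.1 = s.1 :=
          Finset.eq_of_subset_of_card_le Finset.inter_subset_left (by rw [s.2]; omega)
        exact Subtype.ext (Finset.eq_of_subset_of_card_le (Finset.inter_eq_left.1 h5)
          (by rw [s.2, t.2]))
      · exact h
    obtain ⟨j, hj⟩ := Nat.exists_eq_add_of_lt hlt
    rw [zero_add] at hj
    have e1 : M - ((s.1 ∩ t.1).card + 1) = j := by omega
    have e2 : M - (s.1 ∩ t.1).card = j + 1 := by omega
    have := gg_succ e j
    rw [e1, e2, hj, if_neg hst]
    push_cast
    rw [this]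
    simp only [smul_eq_mul, mul_zero, sub_zero]
    field_simp
    ring

noncomputable def lam (e N M k : ℕ) : ℝ :=
  ((Nat.choose (e + k) k : ℝ) * (Nat.choose (N + e + 1) M : ℝ)) /
    ((Nat.choose (M + e + 1) M : ℝ) * (Nat.choose (N + e + 1) k : ℝ))

theorem lam_succ (e N M k : ℕ) (h : M ≤ N) :
    lam e N (M + 1) k = ((N : ℝ) + e + 1 - M) / (M + e + 2) * lam e N M k := by
  have a1 := Nat.choose_succ_right_eq (N + e + 1) M
  have a2 := Nat.add_one_mul_choose_eq (M + e + 1) M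
  have a1' : (Nat.choose (N + e + 1) (M + 1) : ℝ) * (M + 1)
      = Nat.choose (N + e + 1) M * ((N : ℝ) + e + 1 - M) := by
    have := congrArg (Nat.cast (R := ℝ)) a1
    rw [Nat.cast_mul, Nat.cast_mul, Nat.cast_sub (by omega)] at this
    push_cast at this
    linarith
  have a2' : ((M : ℝ) + e + 2) * (Nat.choose (M + e + 1) M : ℝ)
      = Nat.choose (M + 1 + e + 1) (M + 1) * ((M : ℝ) + 1) := by
    have := congrArg (Nat.cast (R := ℝ)) a2
    rw [show M + e + 1 + 1 = M + 1 + e + 1 by omega] at this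
    push_cast at this
    linarith
  have hM1 : (0 : ℝ) < (M : ℝ) + 1 := by positivity
  have hK : (0 : ℝ) < (M : ℝ) + e + 2 := by positivity
  have p1 : (0 : ℝ) < Nat.choose (M + e + 1) M := by
    exact_mod_cast Nat.choose_pos (by omega)
  have b1 : (Nat.choose (N + e + 1) (M + 1) : ℝ)
      = Nat.choose (N + e + 1) M * ((N : ℝ) + e + 1 - M) / (M + 1) := by
    rw [eq_div_iff hM1.ne', a1']
  have b2 : (Nat.choose (M + 1 + e + 1) (M + 1) : ℝ)
      = ((M : ℝ) + e + 2) * (Nat.choose (M + e + 1) M : ℝ) / (M + 1) := by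
    rw [eq_div_iff hM1.ne', a2']
  unfold lam
  rw [b1, b2]
  field_simp

theorem lam_self (e N M : ℕ) (h : M + 1 ≤ N) :
    lam e N (M + 1) (M + 1) = ((e : ℝ) + 1) / (M + e + 2) := by
  have p1 : (0 : ℝ) < Nat.choose (N + e + 1) (M + 1) := by
    exact_mod_cast Nat.choose_pos (by omega)
  have p2 : (0 : ℝ) < Nat.choose (M + 1 + e + 1) (M + 1) := by
    exact_mod_cast Nat.choose_pos (by omega)
  have hK : (0 : ℝ) < (M : ℝ) + e + 2 := by positivity
  have a := Nat.choose_mul_succ_eq (e + (M + 1)) (M + 1)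
  rw [show e + (M + 1) + 1 - (M + 1) = e + 1 by omega,
    show e + (M + 1) + 1 = M + 1 + e + 1 by omega] at a
  have a' := congrArg (Nat.cast (R := ℝ)) a
  push_cast at a'
  unfold lam
  rw [div_eq_div_iff (by positivity) hK.ne']
  linear_combination (Nat.choose (N + e + 1) (M + 1) : ℝ) * a'

theorem lam_lt (e N M k : ℕ) (hM : M ≤ N) (hk : 2 * k < N) :
    lam e N M (k + 1) < lam e N M k := by
  have p1 : (0 : ℝ) < Nat.choose (N + e + 1) M := by
    exact_mod_cast Nat.choose_pos (by omega)
  have p2 : (0 : ℝ) < Nat.choose (M + e + 1) M := by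
    exact_mod_cast Nat.choose_pos (by omega)
  have p3 : (0 : ℝ) < Nat.choose (N + e + 1) k := by
    exact_mod_cast Nat.choose_pos (by omega)
  have p4 : (0 : ℝ) < Nat.choose (e + k) k := by
    exact_mod_cast Nat.choose_pos (by omega)
  have p5 : (0 : ℝ) < Nat.choose (N + e + 1) (k + 1) := by
    exact_mod_cast Nat.choose_pos (by omega)
  have a1 := congrArg (Nat.cast (R := ℝ)) (Nat.choose_succ_right_eq (N + e + 1) k)
  have a2 := congrArg (Nat.cast (R := ℝ)) (Nat.add_one_mul_choose_eq (e + k) k)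
  rw [Nat.cast_mul, Nat.cast_mul, Nat.cast_sub (by omega)] at a1
  rw [show e + k + 1 = e + (k + 1) by omega] at a2
  push_cast at a1 a2
  have hk' : (2 : ℝ) * k < N := by exact_mod_cast hk
  have hk1 : (0 : ℝ) < (k : ℝ) + 1 := by positivity
  unfold lam
  rw [div_lt_div_iff₀ (by positivity) (by positivity)]
  have key : (Nat.choose (e + (k + 1)) (k + 1) : ℝ) * Nat.choose (N + e + 1) k
      < Nat.choose (e + k) k * Nat.choose (N + e + 1) (k + 1) := by
    refine lt_of_mul_lt_mul_right ?_ hk1.le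
    have : (0 : ℝ) < Nat.choose (e + k) k * Nat.choose (N + e + 1) k := by positivity
    nlinarith
  have := mul_lt_mul_of_pos_right key (mul_pos p1 p2)
  linarith

theorem lam_anti (e N M : ℕ) (hMN : 2 * M ≤ N) {i j : ℕ} (hij : i < j) (hj : j ≤ M) :
    lam e N M j < lam e N M i := by
  induction j, hij using Nat.le_induction with
  | base => exact lam_lt e N M i (by omega) (by omega)
  | succ j hij ih => exact (lam_lt e N M j (by omega) (by omega)).trans (ih (by omega))

def mult (N k : ℕ) : ℕ := Nat.choose N k - if k = 0 then 0 else Nat.choose N (k - 1)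

open Polynomial in
theorem charpoly_GF (e N M : ℕ) (hMN : 2 * M ≤ N) : ∀ a b : ℝ,
    (a • GF e N M + b • (1 : Matrix _ _ ℝ)).charpoly =
      ∏ k ∈ Finset.range (M + 1), (X - C (a * lam e N M k + b)) ^ mult N k := by
  induction M with
  | zero =>
    intro a b
    have hG : a • GF e N 0 + b • (1 : Matrix _ _ ℝ) = Matrix.diagonal (fun _ => a + b) := by
      ext s t
      have hs := Finset.card_eq_zero.1 s.2
      have ht := Finset.card_eq_zero.1 t.2
      have : s = t := Subtype.ext (hs.trans ht.symm)
      subst this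
      simp [GF, gg_zero]
    rw [hG, Matrix.charpoly_diagonal]
    simp [lam, mult, Fintype.card_finset_len]
  | succ M ih =>
    intro a b
    have hK : (0 : ℝ) < M + e + 2 := by positivity
    set l : ℝ := ((e : ℝ) + 1) / (M + e + 2) with hl
    have h1 : a • GF e N (M + 1) + b • (1 : Matrix _ _ ℝ)
        = (a • EE N M) * BB e N M + (a * l + b) • (1 : Matrix _ _ ℝ) := by
      rw [Matrix.smul_mul, EB_eq, smul_sub, smul_smul, add_smul]
      abel
    have h2 : BB e N M * (a • EE N M) = (a * (((N : ℝ) + e + 1 - M) / (M + e + 2))) • GF e N M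
        + (-(a * l)) • (1 : Matrix _ _ ℝ) := by
      rw [Matrix.mul_smul, BE_eq e N M hMN, smul_sub, smul_smul, smul_smul, neg_smul]
      abel
    have hle : Fintype.card (FS N M) ≤ Fintype.card (FS N (M + 1)) := by
      simp only [FS, Fintype.card_finset_len, Fintype.card_fin]
      exact Nat.choose_le_succ_of_lt_half_left (by omega)
    rw [h1, charpoly_shift_aux, Matrix.charpoly_mul_comm_of_le _ _ hle, h2, ih (by omega),
      mul_comp, Finset.prod_range_succ _ (M + 1), mul_comm, prod_comp]
    congr 1
    · refine Finset.prod_congr rfl fun k hk => ?_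
      rw [pow_comp, sub_comp, X_comp, C_comp, lam_succ e N M k (by omega)]
      congr 1
      rw [sub_sub, ← C_add]
      congr 2
      ring
    · rw [pow_comp, X_comp, lam_self e N M (by omega), ← hl]
      simp [FS, Fintype.card_finset_len, mult]

def strEquiv (N M : ℕ) : WtStr N M ≃ FS N M where
  toFun x := ⟨Finset.univ.filter (fun i => x.1 i = true), x.2⟩
  invFun s := ⟨fun i => decide (i ∈ s.1), by simp [wt, s.2]⟩
  left_inv x := by apply Subtype.ext; funext i; simp
  right_inv s := by apply Subtype.ext; ext i; simp

theorem gMat_eq (e N M : ℕ) :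
    gMatM (e + 2) M (N := N) (fun _ => false)
      = Matrix.reindex (strEquiv N M).symm (strEquiv N M).symm (GF e N M) := by
  ext x z
  have h : ((strEquiv N M x).1 ∩ (strEquiv N M z).1).card = dotB x.1 z.1 := by
    unfold dotB strEquiv
    simp only [Equiv.coe_fn_mk]
    congr 1
    ext i
    simp
  have hle : dotB x.1 z.1 ≤ M := by
    rw [← h]
    exact (Finset.card_le_card Finset.inter_subset_left).trans_eq (strEquiv N M x).2
  simp only [gMatM, gEnt, Matrix.of_apply, Matrix.reindex_apply, Matrix.submatrix_apply, GF,
    Equiv.symm_symm, h, gg]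
  have hw : wt (fun i => (!x.1 i && !z.1 i && false)) = 0 := by simp [wt]
  rw [hw]
  congr 3
  omega

/-- The characteristic polynomial of `G_0^{(M)}` is
`Π_{k=0}^{M} (X − λ_k)^{m_k}` with
`λ_k = C(d−2+k,k)·C(N+d−1,M)/(C(M+d−1,M)·C(N+d−1,k))` and
`m_k = C(N,k) − C(N,k−1)` (with `C(N,−1) = 0`); in particular each `λ_k` is an
eigenvalue of `G_0^{(M)}` with (algebraic) multiplicity `m_k`. -/
theorem charpoly_G0 (N d M : ℕ) (hd : 2 ≤ d) (hM : 1 ≤ M) (hMN : 2 * M ≤ N) :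
    Matrix.charpoly (gMatM d M (N := N) (fun _ => false)) =
      (∏ k ∈ Finset.range (M + 1),
        (Polynomial.X - Polynomial.C
            (((Nat.choose (d - 2 + k) k : ℝ) * (Nat.choose (N + d - 1) M : ℝ)) /
              ((Nat.choose (M + d - 1) M : ℝ) * (Nat.choose (N + d - 1) k : ℝ)))) ^
          (Nat.choose N k - if k = 0 then 0 else Nat.choose N (k - 1)))
    ∧ ∀ k ≤ M,
        Polynomial.rootMultiplicity
            (((Nat.choose (d - 2 + k) k : ℝ) * (Nat.choose (N + d - 1) M : ℝ)) /
              ((Nat.choose (M + d - 1) M : ℝ) * (Nat.choose (N + d - 1) k : ℝ)))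
            (Matrix.charpoly (gMatM d M (N := N) (fun _ => false)))
          = Nat.choose N k - if k = 0 then 0 else Nat.choose N (k - 1) := by
  obtain ⟨e, rfl⟩ : ∃ e, d = e + 2 := ⟨d - 2, by omega⟩
  have hc : Matrix.charpoly (gMatM (e + 2) M (N := N) (fun _ => false)) =
      ∏ k ∈ Finset.range (M + 1), (Polynomial.X - Polynomial.C (lam e N M k)) ^ mult N k := by
    have h := charpoly_GF e N M hMN 1 0
    simp only [one_smul, zero_smul, add_zero, one_mul] at h
    rw [gMat_eq, Matrix.charpoly_reindex, h]
  refine ⟨hc, fun k hk => ?_⟩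
  rw [hc]
  change Polynomial.rootMultiplicity (lam e N M k) _ = mult N k
  have hne : ∀ j, (Polynomial.X - Polynomial.C (lam e N M j)) ^ mult N j ≠ 0 :=
    fun j => pow_ne_zero _ (Polynomial.X_sub_C_ne_zero _)
  rw [← Polynomial.count_roots, Polynomial.roots_prod _ _ (Finset.prod_ne_zero_iff.2 fun j _ => hne j),
    Multiset.count_bind]
  change ∑ j ∈ Finset.range (M + 1), _ = _
  rw [Finset.sum_eq_single k]
  · simp [Polynomial.roots_pow]
  · intro j hj hjk
    have hj' : j ≤ M := by simpa [Nat.lt_succ_iff] using hj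
    have : lam e N M k ≠ lam e N M j := by
      rcases lt_or_gt_of_ne hjk with h | h
      · exact (lam_anti e N M hMN h hk).ne
      · exact (lam_anti e N M hMN h hj').ne'
    simp [Polynomial.roots_pow, Multiset.count_singleton, this]
  · intro h
    exact absurd (Finset.mem_range.2 (Nat.lt_succ_of_le hk)) h
end

section
/- Let d ≥ 2 and N, M be integers with 0 ≤ M ≤ N. Define the real matrix H, indexed by bit strings x, z ∈ {0,1}^N of Hamming weight M, by H_{x,z} = ((d+M−1)(N+d−M−1) / ((d−1)(d+N−1))) · (−1)^{M + x·z} / C(d+N−2, M − x·z). Then H is the inverse of G_0^{(M)}: G_0^{(M)} · H = H · G_0^{(M)} = I. -/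
open Finset in
theorem aux_L (s : ℝ) (m : ℕ) (f : ℕ → ℝ) :
    ∑ j ∈ range (m + 1 + 1), s ^ j * ((m + 1).choose j : ℝ) * f j
      = ∑ j ∈ range (m + 1), s ^ j * (m.choose j : ℝ) * (f j + s * f (j + 1)) := by
  rw [Finset.sum_range_succ']
  have h1 : ∑ j ∈ range (m + 1), s ^ (j + 1) * ((m + 1).choose (j + 1) : ℝ) * f (j + 1)
      = ∑ j ∈ range (m + 1), s ^ j * (m.choose j : ℝ) * (s * f (j + 1))
        + ∑ j ∈ range (m + 1), s ^ (j + 1) * (m.choose (j + 1) : ℝ) * f (j + 1) := by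
    rw [← Finset.sum_add_distrib]
    refine Finset.sum_congr rfl fun j _ => ?_
    rw [Nat.choose_succ_succ]
    push_cast
    ring
  have h2 : ∑ j ∈ range (m + 1), s ^ j * (m.choose j : ℝ) * f j
      = ∑ j ∈ range (m + 1), s ^ (j + 1) * (m.choose (j + 1) : ℝ) * f (j + 1)
        + s ^ 0 * (m.choose 0 : ℝ) * f 0 := by
    rw [← Finset.sum_range_succ' (fun j => s ^ j * (m.choose j : ℝ) * f j),
      Finset.sum_range_succ _ (m + 1)]
    simp
  simp only [mul_add, Finset.sum_add_distrib]
  rw [h1, h2]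
  simp
  ring

open Finset in
theorem aux_A (m a : ℕ) :
    ∑ j ∈ range (m + 1), (-1 : ℝ) ^ j * (m.choose j : ℝ) * (1 / ((a : ℝ) + 1 + j))
      = 1 / (((a : ℝ) + 1) * ((m + a + 1).choose (a + 1) : ℝ)) := by
  induction m generalizing a with
  | zero => simp
  | succ m ih =>
    rw [aux_L]
    have e : ∀ j ∈ range (m + 1), (-1 : ℝ) ^ j * (m.choose j : ℝ) *
        (1 / ((a : ℝ) + 1 + j) + (-1) * (1 / ((a : ℝ) + 1 + ((j + 1 : ℕ) : ℝ))))
        = (-1 : ℝ) ^ j * (m.choose j : ℝ) * (1 / ((a : ℝ) + 1 + j))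
          - (-1 : ℝ) ^ j * (m.choose j : ℝ) * (1 / (((a + 1 : ℕ) : ℝ) + 1 + j)) := by
      intro j _
      push_cast
      rw [show (a : ℝ) + 1 + (j + 1) = a + 1 + 1 + j by ring]
      ring
    rw [Finset.sum_congr rfl e, Finset.sum_sub_distrib, ih, ih]
    have h1 : ((m + a + 1 + 1 : ℕ) : ℝ) * ((m + a + 1).choose (a + 1) : ℝ)
        = ((m + (a + 1) + 1).choose (a + 1 + 1) : ℝ) * (a + 1 + 1) := by
      exact_mod_cast Nat.add_one_mul_choose_eq (m + a + 1) (a + 1)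
    have h2 : ((m + 1 + a + 1).choose (a + 1) : ℝ) * (m + 1)
        = ((m + a + 1).choose (a + 1) : ℝ) * (m + a + 2) := by
      have := Nat.choose_mul_succ_eq (m + a + 1) (a + 1)
      rw [show m + a + 1 + 1 - (a + 1) = m + 1 by omega,
        show m + a + 1 + 1 = m + 1 + a + 1 by omega] at this
      have h : (((m + a + 1).choose (a + 1) * (m + 1 + a + 1) : ℕ) : ℝ)
        = (((m + 1 + a + 1).choose (a + 1) * (m + 1) : ℕ) : ℝ) := by rw [this]
      push_cast at h
      linarith
    have p0 : ((m + a + 1).choose (a + 1) : ℝ) ≠ 0 := by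
      exact_mod_cast (Nat.choose_pos (by omega)).ne'
    push_cast at h1 ⊢
    have h1' : ((m + (a + 1) + 1).choose (a + 1 + 1) : ℝ)
       = ((m : ℝ) + a + 1 + 1) * ((m + a + 1).choose (a + 1) : ℝ) / (a + 1 + 1) := by
      rw [h1]; field_simp
    have h2' : ((m + 1 + a + 1).choose (a + 1) : ℝ)
       = ((m + a + 1).choose (a + 1) : ℝ) * (m + a + 2) / (m + 1) := by
      rw [← h2]; field_simp
    rw [h1', h2']
    have p1 : (m : ℝ) + a + 1 + 1 ≠ 0 := by positivity
    have p2 : (m : ℝ) + a + 2 ≠ 0 := by positivity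
    field_simp
    ring

open Finset in
theorem aux_B (E P R : ℕ) :
    ∑ e ∈ range (E + 1), (-1 : ℝ) ^ e * (E.choose e : ℝ) * ((P + E - e).choose (R + E) : ℝ)
      = (P.choose R : ℝ) := by
  induction E with
  | zero => simp
  | succ E ih =>
    rw [aux_L, ← ih]
    refine Finset.sum_congr rfl fun j hj => ?_
    have hj' : j ≤ E := by simpa [Nat.lt_succ_iff] using hj
    rw [show P + (E + 1) - j = (P + E - j) + 1 by omega,
      show P + (E + 1) - (j + 1) = P + E - j by omega, ← add_assoc R, Nat.choose_succ_succ]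
    push_cast
    ring

open Finset in
theorem aux_C (k i q : ℕ) (h : i < k) :
    ∑ e ∈ range (k + 1), (-1 : ℝ) ^ e * (k.choose e : ℝ) * ((q + e).choose i : ℝ) = 0 := by
  induction k generalizing i with
  | zero => omega
  | succ k ih =>
    rw [aux_L]
    cases i with
    | zero => simp
    | succ i =>
      have := ih i (by omega)
      rw [← neg_eq_zero, ← Finset.sum_neg_distrib, ← this]
      refine Finset.sum_congr rfl fun j _ => ?_
      rw [← add_assoc, Nat.choose_succ_succ]
      push_cast
      ring

open Finset in
theorem aux_V (Q A B : ℕ) :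
    ∑ e ∈ range (Q + 1), (Q.choose e : ℝ) * (A.choose (B + e) : ℝ)
      = ((A + Q).choose (B + Q) : ℝ) := by
  induction Q generalizing A B with
  | zero => simp
  | succ Q ih =>
    have := aux_L 1 Q (fun e => (A.choose (B + e) : ℝ))
    simp only [one_pow, one_mul] at this
    rw [this, show A + (Q + 1) = (A + 1) + Q by omega, show B + (Q + 1) = B + 1 + Q by omega,
      ← ih]
    refine Finset.sum_congr rfl fun j _ => ?_
    rw [show B + 1 + j = B + j + 1 by omega, Nat.choose_succ_succ, ← add_assoc]
    push_cast
    ring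

open Finset in
theorem sum_pow_union {α : Type*} [DecidableEq α] (A B : Finset α) (h : Disjoint A B)
    (f : Finset α → ℝ) :
    ∑ J ∈ (A ∪ B).powerset, f J = ∑ P ∈ A.powerset, ∑ Q ∈ B.powerset, f (P ∪ Q) := by
  rw [← Finset.sum_product']
  refine Finset.sum_bij' (fun J _ => (J ∩ A, J ∩ B)) (fun p _ => p.1 ∪ p.2) ?_ ?_ ?_ ?_ ?_
  · intro J _
    simp
  · intro p hp
    simp only [mem_product, mem_powerset] at hp ⊢
    exact Finset.union_subset_union hp.1 hp.2
  · intro J hJ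
    simp only [mem_powerset] at hJ
    simp only
    rw [← Finset.inter_union_distrib_left, Finset.inter_eq_left.2 hJ]
  · rintro ⟨P, Q⟩ hp
    simp only [mem_product, mem_powerset] at hp
    rw [Finset.disjoint_left] at h
    ext a
    · simp only [mem_inter, mem_union]
      have := @hp.1 a; have := @hp.2 a; have := @h a; tauto
    · simp only [mem_inter, mem_union]
      have := @hp.1 a; have := @hp.2 a; have := @h a; tauto
  · intro J hJ
    simp only [mem_powerset] at hJ
    simp only
    rw [← Finset.inter_union_distrib_left, Finset.inter_eq_left.2 hJ]

open Finset in
theorem sum_pow_card {α : Type*} [DecidableEq α] (A B : Finset α) (h : Disjoint A B)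
    (f : ℕ → ℕ → ℝ) :
    ∑ J ∈ (A ∪ B).powerset, f (J ∩ A).card (J ∩ B).card
      = ∑ a ∈ range (A.card + 1), (A.card.choose a : ℝ) *
          ∑ b ∈ range (B.card + 1), (B.card.choose b : ℝ) * f a b := by
  rw [sum_pow_union A B h]
  have e : ∀ P ∈ A.powerset, ∑ Q ∈ B.powerset, f ((P ∪ Q) ∩ A).card ((P ∪ Q) ∩ B).card
      = ∑ b ∈ range (B.card + 1), (B.card.choose b : ℝ) * f P.card b := by
    intro P hP
    have := Finset.sum_powerset_apply_card (x := B) (fun b => f P.card b)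
    simp only [nsmul_eq_mul] at this
    rw [← this]
    refine Finset.sum_congr rfl fun Q hQ => ?_
    rw [mem_powerset] at hP hQ
    have e1 : (P ∪ Q) ∩ A = P := by
      rw [Finset.union_inter_distrib_right, Finset.inter_eq_left.2 hP,
        Finset.disjoint_iff_inter_eq_empty.1 (h.symm.mono_left hQ), Finset.union_empty]
    have e2 : (P ∪ Q) ∩ B = Q := by
      rw [Finset.union_inter_distrib_right, Finset.inter_eq_left.2 hQ,
        Finset.disjoint_iff_inter_eq_empty.1 (h.mono_left hP), Finset.empty_union]
    rw [e1, e2]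
  rw [Finset.sum_congr rfl e]
  have := Finset.sum_powerset_apply_card (x := A)
    (fun a => ∑ b ∈ range (B.card + 1), (B.card.choose b : ℝ) * f a b)
  simpa only [nsmul_eq_mul] using this

/-- numeric part of the inner sum -/
theorem inner_num (D M L a b : ℕ) (ha : a ≤ M) (hb : b ≤ L) :
    ∑ e ∈ Finset.range (L - b + 1), ((L - b).choose e : ℝ) * (((M - a).choose (b + e) : ℝ) *
      ((-1 : ℝ) ^ (b + e) / ((D + M + L).choose (b + e) : ℝ)))
    = (-1 : ℝ) ^ b * ((D + M).choose (D + a + b) : ℝ) / ((D + M + L).choose (M - a) : ℝ) := by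
  have hB := aux_B (L - b) (D + M) (D + a + b)
  rw [← hB, Finset.mul_sum, Finset.sum_div]
  refine Finset.sum_congr rfl fun e he => ?_
  have he' : e ≤ L - b := by simpa [Nat.lt_succ_iff] using he
  rw [show D + M + (L - b) - e = D + M + L - (b + e) by omega,
    show D + a + b + (L - b) = D + M + L - (M - a) by omega]
  have p1 : ((D + M + L).choose (b + e) : ℝ) ≠ 0 := by
    exact_mod_cast (Nat.choose_pos (by omega)).ne'
  have p2 : ((D + M + L).choose (M - a) : ℝ) ≠ 0 := by
    exact_mod_cast (Nat.choose_pos (by omega)).ne'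
  have key : ((D + M + L).choose (M - a) : ℝ) * ((M - a).choose (b + e) : ℝ)
      = ((D + M + L).choose (b + e) : ℝ) *
        ((D + M + L - (b + e)).choose (D + M + L - (M - a)) : ℝ) := by
    by_cases h : b + e ≤ M - a
    · have h1 := Nat.choose_mul (n := D + M + L) (k := M - a) (s := b + e) h
      have h2 : (D + M + L - (b + e)).choose (M - a - (b + e))
          = (D + M + L - (b + e)).choose (D + M + L - (M - a)) := by
        apply Nat.choose_symm_of_eq_add
        omega
      rw [h2] at h1
      exact_mod_cast h1
    · rw [Nat.choose_eq_zero_of_lt (show M - a < b + e by omega),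
        Nat.choose_eq_zero_of_lt (show D + M + L - (b + e) < D + M + L - (M - a) by omega)]
      simp
  field_simp
  rw [pow_add]
  linear_combination ((L - b).choose e : ℝ) * (-1) ^ b * (-1) ^ e * key

open Finset in
theorem inner_cnt (D M L N : ℕ) (hN : N = M + L) (Z J : Finset (Fin N)) (hZ : Z.card = M) :
    ∑ T ∈ (Jᶜ).powerset, (if T.card + J.card = M then
        (-1 : ℝ) ^ ((J ∪ T) \ Z).card / ((D + M + L).choose ((J ∪ T) \ Z).card : ℝ) else 0)
    = (-1 : ℝ) ^ (J \ Z).card * ((D + M).choose (D + (J ∩ Z).card + (J \ Z).card) : ℝ)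
        / ((D + M + L).choose (M - (J ∩ Z).card) : ℝ) := by
  have ha : (J ∩ Z).card ≤ M := hZ ▸ card_le_card inter_subset_right
  have hZc : (Zᶜ).card = L := by rw [card_compl, hZ, Fintype.card_fin]; omega
  have hb : (J \ Z).card ≤ L := by
    rw [← hZc]; apply card_le_card; intro i; simp
  have hJ : (J ∩ Z).card + (J \ Z).card = J.card := card_inter_add_card_sdiff J Z
  have hA : (Zᶜ \ J).card = L - (J \ Z).card := by
    rw [← hZc, card_sdiff]; congr 2; ext i; simp
  have hB : (Z \ J).card = M - (J ∩ Z).card := by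
    rw [← hZ, card_sdiff]
  have hU : Jᶜ = (Zᶜ \ J) ∪ (Z \ J) := by ext i; simp; tauto
  have hD : Disjoint (Zᶜ \ J) (Z \ J) := by
    rw [Finset.disjoint_left]; intro i; simp; tauto
  have e : ∀ T ∈ (Jᶜ).powerset, (if T.card + J.card = M then
        (-1 : ℝ) ^ ((J ∪ T) \ Z).card / ((D + M + L).choose ((J ∪ T) \ Z).card : ℝ) else 0)
      = (fun e a => if e + a + J.card = M then
          (-1 : ℝ) ^ ((J \ Z).card + e) / ((D + M + L).choose ((J \ Z).card + e) : ℝ) else 0)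
        (T ∩ (Zᶜ \ J)).card (T ∩ (Z \ J)).card := by
    intro T hT
    rw [mem_powerset] at hT
    have c1 : T.card = (T ∩ (Zᶜ \ J)).card + (T ∩ (Z \ J)).card := by
      rw [← card_union_of_disjoint (hD.mono inter_subset_right inter_subset_right),
        ← inter_union_distrib_left, ← hU, inter_eq_left.2 hT]
    have c2 : ((J ∪ T) \ Z).card = (J \ Z).card + (T ∩ (Zᶜ \ J)).card := by
      rw [← card_union_of_disjoint]
      · congr 1
        ext i
        have := @hT i
        simp only [mem_compl] at this
        simp only [mem_sdiff, mem_union, mem_inter, mem_compl]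
        tauto
      · rw [Finset.disjoint_left]; intro i; simp; tauto
    rw [c1, c2]
  rw [sum_congr rfl e, hU, sum_pow_card _ _ hD (fun e a => if e + a + J.card = M then
      (-1 : ℝ) ^ ((J \ Z).card + e) / ((D + M + L).choose ((J \ Z).card + e) : ℝ) else 0), hA, hB, ← inner_num D M L _ _ ha hb]
  refine sum_congr rfl fun e _ => ?_
  congr 1
  by_cases h : (J \ Z).card + e ≤ M - (J ∩ Z).card
  · rw [sum_eq_single (M - (J ∩ Z).card - ((J \ Z).card + e))]
    · rw [if_pos (by omega), Nat.choose_symm h]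
    · intro a _ hne
      rw [if_neg (by omega), mul_zero]
    · intro hn
      simp only [mem_range] at hn
      omega
  · rw [Nat.choose_eq_zero_of_lt (show M - (J ∩ Z).card < (J \ Z).card + e by omega),
      Nat.cast_zero, zero_mul]
    apply sum_eq_zero
    intro a _
    rw [if_neg (by omega), mul_zero]

open Finset in
theorem outer_num (D M k Q : ℕ) (hk : k ≤ M) :
    ∑ a ∈ range (k + 1), (k.choose a : ℝ) * ∑ b ∈ range (Q + 1), (Q.choose b : ℝ) *
      (((-1 : ℝ) ^ (a + b) * (((D : ℝ) + 1) / ((D : ℝ) + 1 + (a + b : ℕ)))) *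
       ((-1 : ℝ) ^ b * ((D + M).choose (D + a + b) : ℝ) /
        ((D + M + (k + Q)).choose (M - a) : ℝ)))
    = if k = 0 then ((D : ℝ) + 1) * (D + M + Q + 1) / ((D + M + 1) * (D + Q + 1)) else 0 := by
  have h1 : ∀ a ∈ range (k + 1), (k.choose a : ℝ) * ∑ b ∈ range (Q + 1), (Q.choose b : ℝ) *
      (((-1 : ℝ) ^ (a + b) * (((D : ℝ) + 1) / ((D : ℝ) + 1 + (a + b : ℕ)))) *
       ((-1 : ℝ) ^ b * ((D + M).choose (D + a + b) : ℝ) /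
        ((D + M + (k + Q)).choose (M - a) : ℝ)))
      = ((D : ℝ) + 1) / (D + M + 1) * ((-1 : ℝ) ^ a * (k.choose a : ℝ) *
        (((D + M + 1 + Q).choose (D + 1 + a + Q) : ℝ) /
          ((D + M + (k + Q)).choose (M - a) : ℝ))) := by
    intro a ha
    rw [← aux_V, sum_div, mul_sum, mul_sum, mul_sum]
    refine sum_congr rfl fun b _ => ?_
    have s1 := Nat.add_one_mul_choose_eq (D + M) (D + a + b)
    have s2 : ((D : ℝ) + M + 1) * ((D + M).choose (D + a + b) : ℝ)
      = ((D + M + 1).choose (D + 1 + a + b) : ℝ) * (D + a + b + 1) := by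
      rw [show D + 1 + a + b = D + a + b + 1 by omega]
      exact_mod_cast s1
    have s3 : ((D + M + 1).choose (D + 1 + a + b) : ℝ)
      = ((D : ℝ) + M + 1) * ((D + M).choose (D + a + b) : ℝ) / (D + a + b + 1) := by
      rw [s2]; field_simp
    rw [s3, pow_add]
    have sq : (-1 : ℝ) ^ b * (-1) ^ b = 1 := by rw [← mul_pow]; simp
    push_cast
    have p : (D : ℝ) + 1 + (a + b) = D + a + b + 1 := by ring
    rw [p]
    have p1 : (D : ℝ) + M + 1 ≠ 0 := by positivity
    have p2 : (D : ℝ) + a + b + 1 ≠ 0 := by positivity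
    field_simp
    linear_combination (k.choose a : ℝ) * (Q.choose b : ℝ) * ((D + M).choose (D + a + b) : ℝ) *
      ((D + M + (k + Q)).choose (M - a) : ℝ)⁻¹ * sq
  rw [sum_congr rfl h1, ← mul_sum]
  cases k with
  | zero =>
    simp only [zero_add, range_one, sum_singleton, if_true]
    have t := Nat.choose_mul_succ_eq (D + M + Q) M
    have t1 : (D + M + 1 + Q).choose (D + 1 + 0 + Q) = (D + M + Q + 1).choose M := by
      rw [show D + M + 1 + Q = D + M + Q + 1 by omega]
      apply Nat.choose_symm_of_eq_add; omega
    rw [t1]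
    rw [show D + M + Q + 1 - M = D + Q + 1 by omega] at t
    have t2 : ((D + M + Q).choose M : ℝ) * (D + M + Q + 1)
      = ((D + M + Q + 1).choose M : ℝ) * (D + Q + 1) := by exact_mod_cast t
    have t3 : ((D + M + Q + 1).choose M : ℝ)
      = ((D + M + Q).choose M : ℝ) * (D + M + Q + 1) / (D + Q + 1) := by
      rw [t2]; field_simp
    have p1 : ((D + M + Q).choose M : ℝ) ≠ 0 := by
      exact_mod_cast (Nat.choose_pos (by omega)).ne'
    rw [t3]
    simp
    field_simp
  | succ k =>
    rw [if_neg (by omega)]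
    have e : ∀ a ∈ range (k + 1 + 1), (-1 : ℝ) ^ a * ((k + 1).choose a : ℝ) *
        (((D + M + 1 + Q).choose (D + 1 + a + Q) : ℝ) /
          ((D + M + (k + 1 + Q)).choose (M - a) : ℝ))
        = (-1 : ℝ) ^ a * ((k + 1).choose a : ℝ) * (((D + Q + k + 1) + a).choose k : ℝ) *
          (1 / ((D + M + (k + 1 + Q)).choose k : ℝ)) := by
      intro a ha
      simp only [mem_range] at ha
      have p1 : ((D + M + (k + 1 + Q)).choose (M - a) : ℝ) ≠ 0 := by
        exact_mod_cast (Nat.choose_pos (by omega)).ne'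
      have p2 : ((D + M + (k + 1 + Q)).choose k : ℝ) ≠ 0 := by
        exact_mod_cast (Nat.choose_pos (by omega)).ne'
      have u : (D + M + (k + 1 + Q)).choose k * (D + M + 1 + Q).choose (D + 1 + a + Q)
          = (D + M + (k + 1 + Q)).choose (M - a) * ((D + Q + k + 1) + a).choose k := by
        have v1 := Nat.choose_mul (n := D + M + (k + 1 + Q)) (k := M - a + k) (s := k) (by omega)
        have v2 := Nat.choose_mul (n := D + M + (k + 1 + Q)) (k := M - a + k) (s := M - a)
          (by omega)
        rw [show D + M + (k + 1 + Q) - k = D + M + 1 + Q by omega,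
          show M - a + k - k = M - a by omega] at v1
        rw [show D + M + (k + 1 + Q) - (M - a) = D + Q + k + 1 + a by omega,
          show M - a + k - (M - a) = k by omega] at v2
        rw [show (D + M + 1 + Q).choose (D + 1 + a + Q) = (D + M + 1 + Q).choose (M - a) by
          apply Nat.choose_symm_of_eq_add; omega, ← v1, ← v2,
          Nat.choose_symm_of_eq_add (n := M - a + k) (a := k) (b := M - a) (by omega)]
      have u' : ((D + M + (k + 1 + Q)).choose k : ℝ) *
          ((D + M + 1 + Q).choose (D + 1 + a + Q) : ℝ)
          = ((D + M + (k + 1 + Q)).choose (M - a) : ℝ) *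
            (((D + Q + k + 1) + a).choose k : ℝ) := by
        exact_mod_cast u
      field_simp
      linear_combination ((k + 1).choose a : ℝ) * u'
    rw [sum_congr rfl e, ← sum_mul, aux_C (k + 1) k _ (by omega)]
    simp

open Finset in
theorem gexp {N : ℕ} (D : ℕ) (S : Finset (Fin N)) :
    1 / ((S.card + D + 1).choose (D + 1) : ℝ)
      = ∑ J ∈ S.powerset, (-1 : ℝ) ^ J.card * (((D : ℝ) + 1) / ((D : ℝ) + 1 + J.card)) := by
  have := Finset.sum_powerset_apply_card (x := S)
    (fun j => (-1 : ℝ) ^ j * (((D : ℝ) + 1) / ((D : ℝ) + 1 + j)))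
  rw [this]
  have h := aux_A S.card D
  have h2 : 1 / ((S.card + D + 1).choose (D + 1) : ℝ) = ((D : ℝ) + 1) *
     (1 / (((D : ℝ) + 1) * ((S.card + D + 1).choose (D + 1) : ℝ))) := by
    have p1 : ((S.card + D + 1).choose (D + 1) : ℝ) ≠ 0 := by
      exact_mod_cast (Nat.choose_pos (by omega)).ne'
    field_simp
  rw [h2, ← h, mul_sum]
  refine sum_congr rfl fun j _ => ?_
  rw [nsmul_eq_mul]
  ring

open Finset in
theorem main_sum (D M L N : ℕ) (hN : N = M + L) (X Z : Finset (Fin N)) (hX : X.card = M)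
    (hZ : Z.card = M) :
    ∑ W ∈ powersetCard M (univ : Finset (Fin N)),
      1 / (((W \ X).card + D + 1).choose (D + 1) : ℝ) *
        ((-1 : ℝ) ^ (W \ Z).card / ((D + M + L).choose (W \ Z).card : ℝ))
    = if X = Z then ((D : ℝ) + 1) * (D + M + L + 1) / ((D + M + 1) * (D + L + 1)) else 0 := by
  have s1 : ∀ W ∈ powersetCard M (univ : Finset (Fin N)),
      1 / (((W \ X).card + D + 1).choose (D + 1) : ℝ) *
        ((-1 : ℝ) ^ (W \ Z).card / ((D + M + L).choose (W \ Z).card : ℝ))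
      = ∑ J ∈ (W \ X).powerset, ((-1 : ℝ) ^ J.card * (((D : ℝ) + 1) / ((D : ℝ) + 1 + J.card))) *
        ((-1 : ℝ) ^ (W \ Z).card / ((D + M + L).choose (W \ Z).card : ℝ)) := by
    intro W _
    rw [gexp, sum_mul]
  rw [sum_congr rfl s1]
  rw [sum_comm' (t' := (Xᶜ).powerset)
    (s' := fun J => (powersetCard M (univ : Finset (Fin N))).filter (fun W => J ⊆ W))]
  swap
  · intro W J
    simp only [mem_powerset, mem_filter, subset_sdiff, subset_compl_iff_disjoint_right]
    tauto
  have s2 : ∀ J ∈ (Xᶜ).powerset,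
      ∑ W ∈ (powersetCard M (univ : Finset (Fin N))).filter (fun W => J ⊆ W),
        ((-1 : ℝ) ^ J.card * (((D : ℝ) + 1) / ((D : ℝ) + 1 + J.card))) *
        ((-1 : ℝ) ^ (W \ Z).card / ((D + M + L).choose (W \ Z).card : ℝ))
      = (fun a b => ((-1 : ℝ) ^ (a + b) * (((D : ℝ) + 1) / ((D : ℝ) + 1 + (a + b : ℕ)))) *
       ((-1 : ℝ) ^ b * ((D + M).choose (D + a + b) : ℝ) /
        ((D + M + L).choose (M - a) : ℝ))) (J ∩ (Z \ X)).card (J ∩ (Zᶜ \ X)).card := by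
    intro J hJ
    rw [mem_powerset] at hJ
    have e1 : J ∩ (Z \ X) = J ∩ Z := by
      ext i; have := @hJ i; simp only [mem_compl] at this; simp; tauto
    have e2 : J ∩ (Zᶜ \ X) = J \ Z := by
      ext i; have := @hJ i; simp only [mem_compl] at this; simp; tauto
    simp only [e1, e2, card_inter_add_card_sdiff]
    rw [← mul_sum, ← inner_cnt D M L N hN Z J hZ, ← sum_filter]
    congr 1
    refine sum_bij' (fun W _ => W \ J) (fun T _ => J ∪ T) ?_ ?_ ?_ ?_ ?_
    · intro W hW
      simp only [mem_filter, mem_powersetCard, subset_univ, true_and, mem_powerset] at hW ⊢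
      refine ⟨fun i => by simp, ?_⟩
      rw [card_sdiff_add_card_eq_card hW.2, hW.1]
    · intro T hT
      simp only [mem_filter, mem_powersetCard, subset_univ, true_and, mem_powerset] at hT ⊢
      refine ⟨?_, subset_union_left⟩
      rw [card_union_of_disjoint, ← hT.2, add_comm]
      exact (subset_compl_iff_disjoint_left.1 hT.1)
    · intro W hW
      simp only [mem_filter] at hW
      exact union_sdiff_of_subset hW.2
    · intro T hT
      simp only [mem_filter, mem_powerset] at hT
      ext i
      have := @hT.1 i
      simp only [mem_compl] at this
      simp; tauto
    · intro W hW
      simp only [mem_filter] at hW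
      rw [union_sdiff_of_subset hW.2]
  rw [sum_congr rfl s2]
  have hU : Xᶜ = (Z \ X) ∪ (Zᶜ \ X) := by ext i; simp; tauto
  have hD : Disjoint (Z \ X) (Zᶜ \ X) := by
    rw [Finset.disjoint_left]; intro i; simp; tauto
  have hc : (Z \ X).card + (Zᶜ \ X).card = L := by
    rw [← card_union_of_disjoint hD, ← hU, card_compl, hX, Fintype.card_fin]; omega
  have hk : (Z \ X).card ≤ M := hZ ▸ card_le_card sdiff_subset
  rw [hU, sum_pow_card _ _ hD (fun a b =>
      ((-1 : ℝ) ^ (a + b) * (((D : ℝ) + 1) / ((D : ℝ) + 1 + (a + b : ℕ)))) *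
       ((-1 : ℝ) ^ b * ((D + M).choose (D + a + b) : ℝ) /
        ((D + M + L).choose (M - a) : ℝ)))]
  have fin := outer_num D M (Z \ X).card (Zᶜ \ X).card hk
  rw [hc] at fin
  rw [fin]
  have iff1 : (Z \ X).card = 0 ↔ X = Z := by
    rw [card_eq_zero, sdiff_eq_empty_iff_subset]
    constructor
    · intro h
      exact (eq_of_subset_of_card_le h (by omega)).symm
    · rintro rfl; exact subset_rfl
  by_cases h : X = Z
  · rw [if_pos (iff1.2 h), if_pos h]
    rw [iff1.2 h, zero_add] at hc
    rw [hc]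
  · rw [if_neg (fun h' => h (iff1.1 h')), if_neg h]

/-- support of a bit string -/
def supB {N : ℕ} (x : Fin N → Bool) : Finset (Fin N) := Finset.univ.filter (fun i => x i = true)

theorem supB_inj {N : ℕ} {x z : Fin N → Bool} (h : supB x = supB z) : x = z := by
  funext i
  have := Finset.ext_iff.1 h i
  simp only [supB, Finset.mem_filter, Finset.mem_univ, true_and] at this
  exact Bool.eq_iff_iff.2 this

theorem dotB_eq {N : ℕ} (x z : Fin N → Bool) : dotB x z = (supB x ∩ supB z).card := by
  rw [dotB, supB, supB, Finset.filter_and]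

open Finset in
theorem sum_wt (N M : ℕ) (f : Finset (Fin N) → ℝ) :
    ∑ w : WtStr N M, f (supB w.1) = ∑ W ∈ powersetCard M (univ : Finset (Fin N)), f W := by
  refine sum_bij (fun w _ => supB w.1) ?_ ?_ ?_ ?_
  · intro w _
    rw [mem_powersetCard]
    exact ⟨subset_univ _, w.2⟩
  · intro a _ b _ h
    exact Subtype.ext (supB_inj h)
  · intro W hW
    rw [mem_powersetCard] at hW
    have : supB (fun i => decide (i ∈ W)) = W := by ext i; simp [supB]
    exact ⟨⟨fun i => decide (i ∈ W), by rw [← hW.2]; exact congrArg card this⟩, mem_univ _, this⟩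
  · intro w _; rfl

/-- The inverse of `G_0^{(M)}` is given explicitly by
`H_{x,z} = ((d+M−1)(N+d−M−1)/((d−1)(d+N−1))) · (−1)^{M+x·z} / C(d+N−2, M−x·z)`. -/
theorem inverse_G0 (N d M : ℕ) (hN : 1 ≤ N) (hd : 2 ≤ d) (hMN : M ≤ N) :
    gMatM d M (N := N) (fun _ => false) *
        (Matrix.of fun x z : WtStr N M =>
          ((((d : ℝ) + M - 1) * ((N : ℝ) + d - M - 1)) /
              (((d : ℝ) - 1) * ((d : ℝ) + N - 1))) *
            ((-1 : ℝ) ^ (M + dotB x.1 z.1) /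
              (Nat.choose (d + N - 2) (M - dotB x.1 z.1) : ℝ)))
      = 1
    ∧ (Matrix.of fun x z : WtStr N M =>
          ((((d : ℝ) + M - 1) * ((N : ℝ) + d - M - 1)) /
              (((d : ℝ) - 1) * ((d : ℝ) + N - 1))) *
            ((-1 : ℝ) ^ (M + dotB x.1 z.1) /
              (Nat.choose (d + N - 2) (M - dotB x.1 z.1) : ℝ))) *
        gMatM d M (N := N) (fun _ => false)
      = 1 := by
  refine (fun h => ⟨h, mul_eq_one_comm.1 h⟩) ?_
  obtain ⟨D, rfl⟩ : ∃ D, d = D + 2 := ⟨d - 2, by omega⟩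
  obtain ⟨L, hL⟩ : ∃ L, N = M + L := ⟨N - M, by omega⟩
  ext x z
  rw [Matrix.mul_apply]
  have hx : (supB x.1).card = M := x.2
  have hz : (supB z.1).card = M := z.2
  have key := main_sum D M L N hL (supB x.1) (supB z.1) hx hz
  rw [← sum_wt] at key
  have hNr : (N : ℝ) = M + L := by rw [hL]; push_cast; rfl
  have step : ∀ w : WtStr N M,
      gMatM (D + 2) M (N := N) (fun _ => false) x w *
        (Matrix.of fun x z : WtStr N M =>
          (((((D + 2 : ℕ) : ℝ) + M - 1) * ((N : ℝ) + ((D + 2 : ℕ) : ℝ) - M - 1)) /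
              ((((D + 2 : ℕ) : ℝ) - 1) * (((D + 2 : ℕ) : ℝ) + N - 1))) *
            ((-1 : ℝ) ^ (M + dotB x.1 z.1) /
              (Nat.choose (D + 2 + N - 2) (M - dotB x.1 z.1) : ℝ))) w z
      = (((D : ℝ) + M + 1) * (D + L + 1) / ((D + 1) * (D + M + L + 1))) *
        (1 / (((supB w.1 \ supB x.1).card + D + 1).choose (D + 1) : ℝ) *
        ((-1 : ℝ) ^ (supB w.1 \ supB z.1).card /
          ((D + M + L).choose (supB w.1 \ supB z.1).card : ℝ))) := by
    intro w
    have hw : (supB w.1).card = M := w.2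
    have c1 := Finset.card_inter_add_card_sdiff (supB w.1) (supB x.1)
    have c2 := Finset.card_inter_add_card_sdiff (supB w.1) (supB z.1)
    have w0 : wt (fun i => (!x.1 i && !w.1 i && false)) = 0 := by simp [wt]
    simp only [gMatM, gEnt, Matrix.of_apply, w0, dotB_eq, Finset.inter_comm (supB x.1)]
    have par : (-1 : ℝ) ^ (M + (supB w.1 ∩ supB z.1).card)
        = (-1 : ℝ) ^ (supB w.1 \ supB z.1).card := by
      rw [show M + (supB w.1 ∩ supB z.1).card
        = (supB w.1 \ supB z.1).card + 2 * (supB w.1 ∩ supB z.1).card by omega, pow_add, pow_mul]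
      simp
    rw [par, show M + (D + 2) - 1 - (supB w.1 ∩ supB x.1).card + 0
        = (supB w.1 \ supB x.1).card + D + 1 by omega, show D + 2 - 1 = D + 1 by omega,
      show M - (supB w.1 ∩ supB z.1).card = (supB w.1 \ supB z.1).card by omega,
      show D + 2 + N - 2 = D + M + L by omega, hNr]
    have q : ((((D + 2 : ℕ) : ℝ) + M - 1) * (((M : ℝ) + L) + ((D + 2 : ℕ) : ℝ) - M - 1)) /
              ((((D + 2 : ℕ) : ℝ) - 1) * (((D + 2 : ℕ) : ℝ) + (M + L) - 1))
        = ((D : ℝ) + M + 1) * (D + L + 1) / ((D + 1) * (D + M + L + 1)) := by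
      push_cast
      congr 1 <;> ring
    rw [q]
    ring
  rw [Finset.sum_congr rfl (fun w _ => step w), ← Finset.mul_sum, key, Matrix.one_apply]
  by_cases h : x = z
  · subst h
    simp only [if_true]
    have p1 : (D : ℝ) + M + 1 ≠ 0 := by positivity
    have p2 : (D : ℝ) + M + L + 1 ≠ 0 := by positivity
    have p3 : (D : ℝ) + L + 1 ≠ 0 := by positivity
    have p4 : (D : ℝ) + 1 ≠ 0 := by positivity
    field_simp
  · rw [if_neg (fun h' => h (Subtype.ext (supB_inj h'))), if_neg h, mul_zero]
end
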